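/- Let m ≥ 1, n ≥ 1 and let v_∞^{(m)}(y) = C_{m,n} f_{m,n}((2m)^{1/(2m)}|y|) with C_{m,n} > 0 chosen so that ∫_{ℝ^n} v_∞^{(m)} = 1. Then for every multi-index α ∈ ℕ^n, the function ∂^α v_∞^{(m)} is an eigenfunction of the Fokker–Planck operator L v = (−Δ)^m v − ∇·(y v) with eigenvalue |α|; that is, (−Δ)^m (∂^α v_∞^{(m)}) − ∇·( y · ∂^α v_∞^{(m)} ) = |α| · ∂^α v_∞^{(m)} on ℝ^n. -/

import Mathlib

open MeasureTheory Real Filter Topology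

noncomputable def besselJ (ν y : ℝ) : ℝ :=
  ∑' k : ℕ, (-1 : ℝ) ^ k * (y / 2) ^ ((2 * k : ℝ) + ν) /
    (Nat.factorial k * Real.Gamma ((k : ℝ) + ν + 1))

noncomputable def fmn (m n : ℕ) (η : ℝ) : ℝ :=
  η ^ ((1 : ℝ) - n) *
    ∫ s in Set.Ioi (0 : ℝ),
      Real.exp (-(s ^ (2 * m))) * (η * s) ^ ((n : ℝ) / 2) *
        besselJ (((n : ℝ) - 2) / 2) (η * s)
noncomputable def pd {n : ℕ} (i : Fin n) (f : EuclideanSpace ℝ (Fin n) → ℝ)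
    (x : EuclideanSpace ℝ (Fin n)) : ℝ :=
  fderiv ℝ f x (EuclideanSpace.single i 1)

/-- The Laplacian on `ℝⁿ` as a sum of second partial derivatives. -/
noncomputable def lap (n : ℕ) (f : EuclideanSpace ℝ (Fin n) → ℝ) :
    EuclideanSpace ℝ (Fin n) → ℝ :=
  fun x => ∑ i : Fin n, pd i (pd i f) x

/-- The divergence `∇·(y w)` of the vector field `y ↦ y·w(y)`. -/
noncomputable def divYV (n : ℕ) (v : EuclideanSpace ℝ (Fin n) → ℝ)
    (x : EuclideanSpace ℝ (Fin n)) : ℝ :=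
  ∑ i : Fin n, pd i (fun z => z i * v z) x

/-- The iterated partial derivative `∂^α` associated to a multi-index `α : Fin n → ℕ`. -/
noncomputable def mderiv {n : ℕ} (a : Fin n → ℕ) (f : EuclideanSpace ℝ (Fin n) → ℝ) :
    EuclideanSpace ℝ (Fin n) → ℝ :=
  (List.finRange n).foldr (fun i g => (fun h x => pd i h x)^[a i] g) f

/-! ### Entire power series -/

/-- Coefficient sequences of everywhere convergent power series. -/
def Ent (b : ℕ → ℝ) : Prop := ∀ r : ℝ, Summable fun k => b k * r ^ k

/-- The sum of a power series. -/
noncomputable def PS (b : ℕ → ℝ) (x : ℝ) : ℝ := ∑' k, b k * x ^ k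

/-- The formal derivative. -/
def DS (b : ℕ → ℝ) : ℕ → ℝ := fun k => ((k : ℝ) + 1) * b (k + 1)

/-- The Euler operator on coefficients. -/
def ES (b : ℕ → ℝ) : ℕ → ℝ := fun k => (k : ℝ) * b k

theorem Ent.abs {b : ℕ → ℝ} (h : Ent b) (r : ℝ) : Summable fun k => |b k| * |r| ^ k := by
  have := (h r).abs
  simpa [abs_mul, abs_pow] using this

theorem Ent.euler {b : ℕ → ℝ} (h : Ent b) : Ent (ES b) := by
  intro r
  refine Summable.of_norm_bounded (h.abs (2 * r)) fun k => ?_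
  have hk : (k : ℝ) ≤ 2 ^ k := by exact_mod_cast (Nat.lt_two_pow_self (n := k)).le
  simp only [ES, norm_mul, norm_pow, Real.norm_eq_abs, abs_mul, mul_pow, Nat.abs_cast, abs_two]
  have : 0 ≤ |b k| * |r| ^ k := by positivity
  nlinarith

theorem DS_eq (b : ℕ → ℝ) (k : ℕ) : DS b k = ES b (k + 1) := by
  simp [DS, ES]

theorem Ent.shift {b : ℕ → ℝ} (h : Ent b) : Ent (fun k => b (k + 1)) := by
  intro r
  by_cases hr : r = 0
  · subst hr
    refine summable_of_ne_finset_zero (s := {0}) fun k hk => ?_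
    simp at hk
    simp [hk]
  · have := ((summable_nat_add_iff 1).2 (h r)).mul_right r⁻¹
    refine this.congr fun k => ?_
    field_simp
    ring

theorem Ent.deriv {b : ℕ → ℝ} (h : Ent b) : Ent (DS b) := by
  have := h.euler.shift
  intro r
  exact (this r).congr fun k => by rw [DS_eq]

theorem PS_hasDerivAt {b : ℕ → ℝ} (h : Ent b) (x : ℝ) : HasDerivAt (PS b) (PS (DS b) x) x := by
  set R : ℝ := |x| + 1 with hR
  have hR0 : 0 < R := by positivity
  have hxs : x ∈ Metric.ball (0 : ℝ) R := by simp [hR]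
  have hsum : ∀ y : ℝ, Summable fun k : ℕ => b k * ((k : ℝ) * y ^ (k - 1)) := by
    intro y
    rw [← summable_nat_add_iff 1]
    refine (h.deriv y).congr fun k => ?_
    simp [DS]; ring
  have hu : Summable fun k : ℕ => |b k| * ((k : ℝ) * R ^ (k - 1)) := by
    refine (hsum R).abs.congr fun k => ?_
    rw [abs_mul, abs_of_nonneg (a := (k : ℝ) * R ^ (k - 1)) (by positivity)]
  have key := hasDerivAt_tsum_of_isPreconnected (g := fun k y => b k * y ^ k)
    (g' := fun k y => b k * ((k : ℝ) * y ^ (k - 1))) (t := Metric.ball 0 R) (y₀ := x) (y := x)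
    hu Metric.isOpen_ball (convex_ball _ _).isPreconnected
    (fun k y _ => (hasDerivAt_pow k y).const_mul (b k))
    (fun k y hy => by
      have hy' : |y| ≤ R := by simpa using (Metric.mem_ball.1 hy).le
      simp only [norm_mul, norm_pow, Real.norm_eq_abs, Nat.abs_cast]
      gcongr) hxs (h x) hxs
  have e : ∑' k : ℕ, b k * ((k : ℝ) * x ^ (k - 1)) = PS (DS b) x := by
    rw [(hsum x).tsum_eq_zero_add]
    simp only [PS, DS]
    simp
    refine tsum_congr fun k => by ring
  rw [← e]
  exact key

theorem mul_PS_DS {b : ℕ → ℝ} (h : Ent b) (x : ℝ) : x * PS (DS b) x = PS (ES b) x := by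
  rw [PS, PS, (h.euler x).tsum_eq_zero_add, ← tsum_mul_left]
  simp only [ES, DS]
  simp
  refine tsum_congr fun k => by ring

theorem PS_contDiff {b : ℕ → ℝ} (h : Ent b) : ContDiff ℝ (⊤ : ℕ∞) (PS b) := by
  rw [contDiff_infty]
  intro N
  induction N generalizing b with
  | zero =>
    simp only [Nat.cast_zero, contDiff_zero]
    exact continuous_iff_continuousAt.2 fun x => (PS_hasDerivAt h x).continuousAt
  | succ N ih =>
    push_cast
    rw [contDiff_succ_iff_deriv]
    refine ⟨fun x => (PS_hasDerivAt h x).differentiableAt, by simp, ?_⟩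
    have : _root_.deriv (PS b) = PS (DS b) := funext fun x => (PS_hasDerivAt h x).deriv
    rw [this]
    exact ih h.deriv

/-! ### Partial derivatives of smooth functions -/

/-- Smooth functions on Euclidean space. -/
def Sm {n : ℕ} (f : EuclideanSpace ℝ (Fin n) → ℝ) : Prop := ContDiff ℝ (⊤ : ℕ∞) f

theorem Sm.differentiable {n : ℕ} {f : EuclideanSpace ℝ (Fin n) → ℝ} (h : Sm f) :
    Differentiable ℝ f := ContDiff.differentiable h (by simp)

theorem Sm.pd {n : ℕ} {f : EuclideanSpace ℝ (Fin n) → ℝ} (h : Sm f) (i : Fin n) :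
    Sm (pd i f) := by
  have : ContDiff ℝ (⊤ : ℕ∞) (fderiv ℝ f) := ContDiff.fderiv_right h (by simp)
  exact this.clm_apply contDiff_const

theorem Sm.coord {n : ℕ} (i : Fin n) : Sm (fun z : EuclideanSpace ℝ (Fin n) => z i) := by
  unfold Sm; fun_prop

theorem Sm.mul {n : ℕ} {f g : EuclideanSpace ℝ (Fin n) → ℝ} (hf : Sm f) (hg : Sm g) :
    Sm (fun z => f z * g z) := ContDiff.mul hf hg

theorem Sm.const_mul {n : ℕ} {f : EuclideanSpace ℝ (Fin n) → ℝ} (hf : Sm f) (c : ℝ) :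
    Sm (fun z => c * f z) := ContDiff.mul contDiff_const hf

theorem Sm.sum {n : ℕ} {f : Fin n → EuclideanSpace ℝ (Fin n) → ℝ} (hf : ∀ j, Sm (f j)) :
    Sm (fun z => ∑ j, f j z) := ContDiff.sum fun j _ => hf j

theorem pd_mul {n : ℕ} {f g : EuclideanSpace ℝ (Fin n) → ℝ} (hf : Sm f) (hg : Sm g) (i : Fin n)
    (x : EuclideanSpace ℝ (Fin n)) :
    pd i (fun z => f z * g z) x = pd i f x * g x + f x * pd i g x := by
  unfold _root_.pd
  rw [fderiv_fun_mul (hf.differentiable x) (hg.differentiable x)]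
  simp; ring

theorem pd_const_mul {n : ℕ} {f : EuclideanSpace ℝ (Fin n) → ℝ} (hf : Sm f) (c : ℝ) (i : Fin n)
    (x : EuclideanSpace ℝ (Fin n)) : pd i (fun z => c * f z) x = c * pd i f x := by
  unfold _root_.pd
  rw [fderiv_const_mul (hf.differentiable x)]
  simp

theorem pd_sum {n : ℕ} {f : Fin n → EuclideanSpace ℝ (Fin n) → ℝ} (hf : ∀ j, Sm (f j)) (i : Fin n)
    (x : EuclideanSpace ℝ (Fin n)) :
    pd i (fun z => ∑ j, f j z) x = ∑ j, pd i (f j) x := by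
  unfold _root_.pd
  rw [fderiv_fun_sum fun j _ => (hf j).differentiable x]
  simp

theorem pd_sub {n : ℕ} {f g : EuclideanSpace ℝ (Fin n) → ℝ} (hf : Sm f) (hg : Sm g) (i : Fin n)
    (x : EuclideanSpace ℝ (Fin n)) :
    pd i (fun z => f z - g z) x = pd i f x - pd i g x := by
  unfold _root_.pd
  rw [fderiv_fun_sub (hf.differentiable x) (hg.differentiable x)]
  simp

theorem pd_coord {n : ℕ} (i j : Fin n) (x : EuclideanSpace ℝ (Fin n)) :
    pd i (fun z => z j) x = if j = i then 1 else 0 := by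
  unfold _root_.pd
  have : HasFDerivAt (fun z : EuclideanSpace ℝ (Fin n) => z j)
    (EuclideanSpace.proj j : EuclideanSpace ℝ (Fin n) →L[ℝ] ℝ) x :=
    (EuclideanSpace.proj j : EuclideanSpace ℝ (Fin n) →L[ℝ] ℝ).hasFDerivAt
  rw [this.fderiv]
  simp

theorem pd_comm {n : ℕ} {f : EuclideanSpace ℝ (Fin n) → ℝ} (hf : Sm f) (i j : Fin n) :
    pd i (pd j f) = pd j (pd i f) := by
  funext x
  have hsymm : IsSymmSndFDerivAt ℝ f x :=
    ContDiffAt.isSymmSndFDerivAt (contDiff_infty.1 hf 2).contDiffAt (by simp)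
  have hd : DifferentiableAt ℝ (fderiv ℝ f) x := by
    have : ContDiff ℝ (⊤ : ℕ∞) (fderiv ℝ f) := ContDiff.fderiv_right hf (by simp)
    exact this.differentiable (by simp) x
  have h : ∀ u v : EuclideanSpace ℝ (Fin n),
      fderiv ℝ (fun y => fderiv ℝ f y u) x v = fderiv ℝ (fderiv ℝ f) x v u := by
    intro u v
    rw [fderiv_clm_apply hd (differentiableAt_const u)]
    simp
  change fderiv ℝ (fun y => fderiv ℝ f y _) x _ = fderiv ℝ (fun y => fderiv ℝ f y _) x _
  rw [h, h]
  exact hsymm.eq _ _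

theorem Sm.lap {n : ℕ} {f : EuclideanSpace ℝ (Fin n) → ℝ} (h : Sm f) : Sm (lap n f) :=
  Sm.sum fun i => (h.pd i).pd i

theorem lap_pd {n : ℕ} {f : EuclideanSpace ℝ (Fin n) → ℝ} (h : Sm f) (i : Fin n) :
    lap n (pd i f) = pd i (lap n f) := by
  funext x
  unfold _root_.lap
  rw [pd_sum (fun j => (h.pd j).pd j)]
  refine Finset.sum_congr rfl fun j _ => ?_
  rw [pd_comm h j i, pd_comm (h.pd j) j i]

theorem Sm.lap_iter {n : ℕ} {f : EuclideanSpace ℝ (Fin n) → ℝ} (h : Sm f) (m : ℕ) :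
    Sm ((_root_.lap n)^[m] f) := by
  induction m generalizing f with
  | zero => exact h
  | succ m ih => exact ih h.lap

theorem lap_iter_pd {n : ℕ} {f : EuclideanSpace ℝ (Fin n) → ℝ} (h : Sm f) (i : Fin n) (m : ℕ) :
    (lap n)^[m] (pd i f) = pd i ((lap n)^[m] f) := by
  induction m generalizing f with
  | zero => rfl
  | succ m ih => rw [Function.iterate_succ_apply, Function.iterate_succ_apply, lap_pd h, ih h.lap]

theorem divYV_eq {n : ℕ} {f : EuclideanSpace ℝ (Fin n) → ℝ} (h : Sm f)
    (x : EuclideanSpace ℝ (Fin n)) :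
    divYV n f x = n * f x + ∑ j, x j * pd j f x := by
  unfold divYV
  simp_rw [pd_mul (Sm.coord _) h, pd_coord, Finset.sum_add_distrib]
  simp

theorem Sm.div {n : ℕ} {f : EuclideanSpace ℝ (Fin n) → ℝ} (h : Sm f) : Sm (divYV n f) :=
  Sm.sum fun i => ((Sm.coord i).mul h).pd i

theorem pd_divYV {n : ℕ} {f : EuclideanSpace ℝ (Fin n) → ℝ} (h : Sm f) (i : Fin n)
    (x : EuclideanSpace ℝ (Fin n)) :
    pd i (divYV n f) x = divYV n (pd i f) x + pd i f x := by
  unfold divYV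
  rw [pd_sum (fun j => ((Sm.coord j).mul h).pd j)]
  have : ∀ j, pd i (pd j (fun z => z j * f z)) x
      = pd j (fun z => z j * pd i f z) x + (if j = i then pd j f x else 0) := by
    intro j
    rw [pd_comm ((Sm.coord j).mul h)]
    have e : pd i (fun z => z j * f z) = fun z => (if j = i then f z else 0) + z j * pd i f z := by
      funext z
      rw [pd_mul (Sm.coord j) h, pd_coord]
      split_ifs <;> simp
    rw [e]
    split_ifs with hji
    · have e2 : (fun z : EuclideanSpace ℝ (Fin n) => f z + z j * pd i f z)
        = fun z => f z - (-1) * (z j * pd i f z) := by funext z; ring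
      rw [e2, pd_sub h (((Sm.coord j).mul (h.pd i)).const_mul _),
        pd_const_mul ((Sm.coord j).mul (h.pd i))]
      ring
    · simp
  simp_rw [this, Finset.sum_add_distrib]
  simp

/-- Eigenfunction property. -/
def Eig (m n : ℕ) (μ : ℝ) (w : EuclideanSpace ℝ (Fin n) → ℝ) : Prop :=
  Sm w ∧ ∀ y, (-1 : ℝ) ^ m * (lap n)^[m] w y - divYV n w y = μ * w y

theorem Eig.pd {m n : ℕ} {μ : ℝ} {w : EuclideanSpace ℝ (Fin n) → ℝ} (h : Eig m n μ w)
    (i : Fin n) : Eig m n (μ + 1) (pd i w) := by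
  obtain ⟨hs, he⟩ := h
  refine ⟨hs.pd i, fun y => ?_⟩
  rw [lap_iter_pd hs]
  have h1 := pd_divYV hs i y
  have h2 : _root_.pd i (fun y => (-1 : ℝ) ^ m * (lap n)^[m] w y - divYV n w y) y
      = _root_.pd i (fun y => μ * w y) y := by
    congr 1; exact funext he
  rw [pd_sub ((hs.lap_iter m).const_mul _) hs.div, pd_const_mul (hs.lap_iter m),
    pd_const_mul hs] at h2
  linarith

theorem Eig.iter {m n : ℕ} {μ : ℝ} {w : EuclideanSpace ℝ (Fin n) → ℝ} (h : Eig m n μ w)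
    (i : Fin n) (k : ℕ) : Eig m n (μ + k) ((fun h x => _root_.pd i h x)^[k] w) := by
  induction k with
  | zero => simpa using h
  | succ k ih =>
    rw [Function.iterate_succ_apply']
    have := ih.pd i
    push_cast
    rw [← add_assoc]
    exact this

theorem Eig.mderiv {m n : ℕ} {w : EuclideanSpace ℝ (Fin n) → ℝ} (h : Eig m n 0 w)
    (a : Fin n → ℕ) : Eig m n (∑ i, (a i : ℝ)) (mderiv a w) := by
  have : ∀ l : List (Fin n), Eig m n ((l.map fun i => (a i : ℝ)).sum)
      (l.foldr (fun i g => (fun h x => _root_.pd i h x)^[a i] g) w) := by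
    intro l
    induction l with
    | nil => simpa using h
    | cons i l ih =>
      simp only [List.map_cons, List.sum_cons, List.foldr_cons]
      rw [add_comm]
      exact ih.iter i (a i)
  have h2 := this (List.finRange n)
  rw [← List.ofFn_eq_map, List.sum_ofFn] at h2
  exact h2

/-! ### Radial power series -/

theorem normsq_eq {n : ℕ} (z : EuclideanSpace ℝ (Fin n)) : ‖z‖ ^ 2 = ∑ j, z j * z j := by
  rw [EuclideanSpace.norm_sq_eq]
  refine Finset.sum_congr rfl fun j _ => ?_
  rw [Real.norm_eq_abs, sq_abs, sq]

theorem Sm.radial {n : ℕ} {b : ℕ → ℝ} (h : Ent b) :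
    Sm (fun z : EuclideanSpace ℝ (Fin n) => PS b (‖z‖ ^ 2)) :=
  (PS_contDiff h).comp (contDiff_norm_sq ℝ)

theorem pd_radial {n : ℕ} {b : ℕ → ℝ} (h : Ent b) (i : Fin n) :
    pd i (fun z : EuclideanSpace ℝ (Fin n) => PS b (‖z‖ ^ 2))
      = fun z => 2 * (z i * PS (DS b) (‖z‖ ^ 2)) := by
  funext z
  have h1 : HasFDerivAt (fun z : EuclideanSpace ℝ (Fin n) => ‖z‖ ^ 2) _ z :=
    (hasStrictFDerivAt_norm_sq z).hasFDerivAt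
  have h2 := (PS_hasDerivAt h (‖z‖ ^ 2)).comp_hasFDerivAt z h1
  unfold _root_.pd
  have h3 := h2.fderiv
  simp only [Function.comp_def] at h3
  rw [h3]
  simp [EuclideanSpace.inner_single_right]
  ring

/-- Action of the Laplacian on the coefficients of a radial power series. -/
def TS (n : ℕ) (b : ℕ → ℝ) : ℕ → ℝ := fun k => 2 * ((k : ℝ) + 1) * (2 * k + n) * b (k + 1)

theorem Ent.add {b c : ℕ → ℝ} (hb : Ent b) (hc : Ent c) (s t : ℝ) :
    Ent (fun k => s * b k + t * c k) := fun r =>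
  (((hb r).mul_left s).add ((hc r).mul_left t)).congr fun k => by ring

theorem PS_add {b c : ℕ → ℝ} (hb : Ent b) (hc : Ent c) (s t x : ℝ) :
    PS (fun k => s * b k + t * c k) x = s * PS b x + t * PS c x := by
  unfold PS
  rw [← tsum_mul_left, ← tsum_mul_left, ← ((hb x).mul_left s).tsum_add ((hc x).mul_left t)]
  exact tsum_congr fun k => by ring

theorem TS_eq (n : ℕ) (b : ℕ → ℝ) : TS n b = fun k => (2 * n) * DS b k + 4 * ES (DS b) k := by
  funext k
  simp only [TS, DS, ES]; ring

theorem Ent.TS {n : ℕ} {b : ℕ → ℝ} (h : Ent b) : Ent (TS n b) := by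
  rw [TS_eq]; exact h.deriv.add h.deriv.euler _ _

theorem lap_radial {n : ℕ} {b : ℕ → ℝ} (h : Ent b) :
    lap n (fun z : EuclideanSpace ℝ (Fin n) => PS b (‖z‖ ^ 2))
      = fun z => PS (TS n b) (‖z‖ ^ 2) := by
  funext z
  unfold _root_.lap
  have : ∀ i, pd i (pd i (fun z : EuclideanSpace ℝ (Fin n) => PS b (‖z‖ ^ 2))) z
      = 2 * PS (DS b) (‖z‖ ^ 2) + 4 * PS (DS (DS b)) (‖z‖ ^ 2) * (z i * z i) := by
    intro i
    rw [pd_radial h, pd_const_mul ((Sm.coord i).mul (Sm.radial h.deriv)),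
      pd_mul (Sm.coord i) (Sm.radial h.deriv), pd_coord, pd_radial h.deriv]
    simp; ring
  simp_rw [this, Finset.sum_add_distrib, ← Finset.mul_sum]
  rw [← normsq_eq, TS_eq, PS_add h.deriv h.deriv.euler, ← mul_PS_DS h.deriv]
  simp; ring

theorem lap_iter_radial {n : ℕ} {b : ℕ → ℝ} (h : Ent b) (m : ℕ) :
    (lap n)^[m] (fun z : EuclideanSpace ℝ (Fin n) => PS b (‖z‖ ^ 2))
      = fun z => PS ((TS n)^[m] b) (‖z‖ ^ 2) := by
  induction m generalizing b with
  | zero => rfl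
  | succ m ih => rw [Function.iterate_succ_apply, Function.iterate_succ_apply, lap_radial h, ih h.TS]

theorem divYV_radial {n : ℕ} {b : ℕ → ℝ} (h : Ent b) (z : EuclideanSpace ℝ (Fin n)) :
    divYV n (fun z : EuclideanSpace ℝ (Fin n) => PS b (‖z‖ ^ 2)) z
      = PS (fun k => n * b k + 2 * ES b k) (‖z‖ ^ 2) := by
  rw [divYV_eq (Sm.radial h), PS_add h h.euler, ← mul_PS_DS h]
  simp_rw [pd_radial h]
  have : ∀ j, z j * (2 * (z j * PS (DS b) (‖z‖ ^ 2)))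
    = (2 * PS (DS b) (‖z‖ ^ 2)) * (z j * z j) := fun j => by ring
  simp_rw [this, ← Finset.mul_sum]
  rw [← normsq_eq]; ring

theorem Eig.radial {m n : ℕ} {b : ℕ → ℝ} (h : Ent b)
    (hrec : ∀ k, (-1 : ℝ) ^ m * (TS n)^[m] b k = (2 * k + n) * b k) :
    Eig m n 0 (fun z : EuclideanSpace ℝ (Fin n) => PS b (‖z‖ ^ 2)) := by
  refine ⟨Sm.radial h, fun y => ?_⟩
  rw [lap_iter_radial h, divYV_radial h]
  simp only [PS]
  rw [← tsum_mul_left, zero_mul, sub_eq_zero]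
  refine tsum_congr fun k => ?_
  rw [← mul_assoc, hrec]
  simp only [ES]; ring

theorem TS_iter {n : ℕ} (hn : 1 ≤ n) (b : ℕ → ℝ) (m k : ℕ) :
    (TS n)^[m] b k = 4 ^ m * ((k + m).factorial / k.factorial : ℝ) *
      (Real.Gamma (k + m + n / 2) / Real.Gamma (k + n / 2)) * b (k + m) := by
  have hn' : (0 : ℝ) < n := by exact_mod_cast hn
  induction m generalizing k with
  | zero =>
    have h1 : Real.Gamma (k + n / 2) ≠ 0 := (Real.Gamma_pos_of_pos (by positivity)).ne'
    have h2 : (k.factorial : ℝ) ≠ 0 := by positivity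
    simp [h1, h2]
  | succ m ih =>
    rw [Function.iterate_succ_apply']
    simp only [TS]
    rw [ih]
    have hp : (0 : ℝ) < k + n / 2 := by positivity
    have h1 : Real.Gamma (k + n / 2) ≠ 0 := (Real.Gamma_pos_of_pos hp).ne'
    have e1 : (((k + 1 : ℕ) : ℝ) + n / 2) = (k + n / 2) + 1 := by push_cast; ring
    have e2 : (((k + 1 : ℕ) : ℝ) + m + n / 2) = k + ((m + 1 : ℕ) : ℝ) + n / 2 := by push_cast; ring
    have e3 : k + 1 + m = k + (m + 1) := by ring
    rw [e1, e2, e3, Real.Gamma_add_one hp.ne', Nat.factorial_succ k]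
    have h2 : (k.factorial : ℝ) ≠ 0 := by positivity
    push_cast
    field_simp
    ring

/-! ### The kernel as a power series -/

/-- Bessel coefficient. -/
noncomputable def cB (n k : ℕ) : ℝ :=
  (-1 : ℝ) ^ k / ((2 : ℝ) ^ ((2 * k : ℝ) + ((n : ℝ) - 2) / 2) *
    (Nat.factorial k * Real.Gamma ((k : ℝ) + n / 2)))

/-- The moments. -/
noncomputable def mI (m n k : ℕ) : ℝ :=
  ∫ s in Set.Ioi (0 : ℝ), s ^ ((2 * k + n - 1 : ℝ)) * Real.exp (-s ^ (2 * m : ℝ))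

theorem mI_integrable {m n : ℕ} (hm : 1 ≤ m) (hn : 1 ≤ n) (k : ℕ) :
    IntegrableOn (fun s : ℝ => s ^ ((2 * k + n - 1 : ℝ)) * Real.exp (-s ^ (2 * m : ℝ)))
      (Set.Ioi 0) := by
  have hn' : (1 : ℝ) ≤ n := by exact_mod_cast hn
  have hm' : (1 : ℝ) ≤ m := by exact_mod_cast hm
  have hk : (0 : ℝ) ≤ k := by positivity
  exact integrableOn_rpow_mul_exp_neg_rpow (by linarith) (by linarith)

theorem mI_eq {m n : ℕ} (hm : 1 ≤ m) (hn : 1 ≤ n) (k : ℕ) :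
    mI m n k = 1 / (2 * m) * Real.Gamma ((2 * k + n) / (2 * m)) := by
  have hn' : (1 : ℝ) ≤ n := by exact_mod_cast hn
  have hm' : (1 : ℝ) ≤ m := by exact_mod_cast hm
  have hk : (0 : ℝ) ≤ k := by positivity
  rw [mI, integral_rpow_mul_exp_neg_rpow (by linarith) (by linarith)]
  congr 3; ring

theorem mI_rec {m n : ℕ} (hm : 1 ≤ m) (hn : 1 ≤ n) (k : ℕ) :
    mI m n (k + m) = (2 * k + n) / (2 * m) * mI m n k := by
  have hn' : (1 : ℝ) ≤ n := by exact_mod_cast hn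
  have hm' : (1 : ℝ) ≤ m := by exact_mod_cast hm
  have hp : (0 : ℝ) < (2 * k + n) / (2 * m) := by positivity
  rw [mI_eq hm hn, mI_eq hm hn]
  have : (2 * ((k + m : ℕ) : ℝ) + n) / (2 * m) = (2 * k + n) / (2 * m) + 1 := by
    push_cast; field_simp; ring
  rw [this, Real.Gamma_add_one hp.ne']; ring

theorem mI_nonneg {m n : ℕ} (hm : 1 ≤ m) (hn : 1 ≤ n) (k : ℕ) : 0 ≤ mI m n k := by
  have hn' : (1 : ℝ) ≤ n := by exact_mod_cast hn
  have hm' : (1 : ℝ) ≤ m := by exact_mod_cast hm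
  rw [mI_eq hm hn]
  have : 0 < Real.Gamma ((2 * k + n) / (2 * m)) := Real.Gamma_pos_of_pos (by positivity)
  positivity

theorem mI_le {m n : ℕ} (hm : 1 ≤ m) (hn : 1 ≤ n) (k : ℕ) :
    mI m n k ≤ Real.exp 1 * Real.Gamma (k + n / 2) := by
  have hn' : (1 : ℝ) ≤ n := by exact_mod_cast hn
  have h1 : mI m n k ≤ Real.exp 1 * mI 1 n k := by
    rw [mI, mI, ← integral_const_mul]
    refine setIntegral_mono_on (mI_integrable hm hn k) ((mI_integrable le_rfl hn k).const_mul _)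
      measurableSet_Ioi fun s hs => ?_
    have hs0 : (0 : ℝ) < s := hs
    have hle : s ^ (2 * ((1 : ℕ) : ℝ)) ≤ s ^ (2 * m : ℝ) + 1 := by
      rcases le_total s 1 with h | h
      · have : s ^ (2 * ((1 : ℕ) : ℝ)) ≤ 1 := Real.rpow_le_one hs0.le h (by simp)
        have : 0 ≤ s ^ (2 * m : ℝ) := by positivity
        linarith
      · have : s ^ (2 * ((1 : ℕ) : ℝ)) ≤ s ^ (2 * m : ℝ) :=
          Real.rpow_le_rpow_of_exponent_le h (by
            have : (1 : ℝ) ≤ m := by exact_mod_cast hm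
            push_cast; linarith)
        linarith
    have : Real.exp (-s ^ (2 * m : ℝ)) ≤ Real.exp 1 * Real.exp (-s ^ (2 * ((1 : ℕ) : ℝ))) := by
      rw [← Real.exp_add]
      exact Real.exp_le_exp.2 (by linarith)
    have h0 : 0 ≤ s ^ ((2 * k + n - 1 : ℝ)) := by positivity
    nlinarith
  refine h1.trans ?_
  rw [mI_eq le_rfl hn]
  have e : (2 * (k : ℝ) + n) / (2 * ((1 : ℕ) : ℝ)) = k + n / 2 := by push_cast; ring
  rw [e]
  have : 0 < Real.Gamma (k + n / 2 : ℝ) := Real.Gamma_pos_of_pos (by positivity)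
  have h3 := Real.exp_pos 1
  refine mul_le_mul_of_nonneg_left ?_ h3.le
  push_cast
  linarith

theorem ent_coef {m n : ℕ} (hm : 1 ≤ m) (hn : 1 ≤ n) : Ent (fun k => cB n k * mI m n k) := by
  intro r
  have hn' : (1 : ℝ) ≤ n := by exact_mod_cast hn
  set A : ℝ := (2 : ℝ) ^ (((n : ℝ) - 2) / 2) with hA
  have hA0 : 0 < A := by positivity
  refine Summable.of_norm_bounded
    ((Real.summable_pow_div_factorial (|r|)).mul_left (Real.exp 1 / A)) fun k => ?_
  have hG : 0 < Real.Gamma (k + n / 2 : ℝ) := Real.Gamma_pos_of_pos (by positivity)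
  have h1 := mI_le hm hn k
  have h0 := mI_nonneg hm hn k
  have hpow : A ≤ (2 : ℝ) ^ ((2 * k : ℝ) + ((n : ℝ) - 2) / 2) :=
    Real.rpow_le_rpow_of_exponent_le (by norm_num) (by
      have : (0 : ℝ) ≤ k := by positivity
      linarith)
  simp only [cB, norm_mul, norm_div, norm_pow, norm_neg, norm_one, one_pow, Real.norm_eq_abs]
  rw [abs_of_nonneg h0, abs_of_pos hG, abs_of_pos (lt_of_lt_of_le hA0 hpow), Nat.abs_cast]
  have hf : (0 : ℝ) < k.factorial := by positivity
  calc 1 / ((2 : ℝ) ^ ((2 * k : ℝ) + ((n : ℝ) - 2) / 2) * (k.factorial * Real.Gamma (k + n / 2)))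
        * mI m n k * |r| ^ k
      ≤ 1 / (A * (k.factorial * Real.Gamma (k + n / 2)))
        * (Real.exp 1 * Real.Gamma (k + n / 2)) * |r| ^ k := by gcongr
    _ = _ := by field_simp

theorem term_eq (m n k : ℕ) {η s : ℝ} (hη : 0 < η) (hs : 0 < s) :
    Real.exp (-(s ^ (2 * m))) * (η * s) ^ ((n : ℝ) / 2) *
      ((-1 : ℝ) ^ k * (η * s / 2) ^ ((2 * k : ℝ) + ((n : ℝ) - 2) / 2) /
        (Nat.factorial k * Real.Gamma ((k : ℝ) + ((n : ℝ) - 2) / 2 + 1)))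
    = (cB n k * η ^ (2 * k + n - 1 : ℝ)) *
        (s ^ ((2 * k + n - 1 : ℝ)) * Real.exp (-s ^ (2 * m : ℝ))) := by
  have e1 : (k : ℝ) + ((n : ℝ) - 2) / 2 + 1 = k + n / 2 := by ring
  have e2 : s ^ (2 * m : ℝ) = s ^ (2 * m) := by
    rw [← Real.rpow_natCast]; push_cast; rfl
  have e3 : (η * s) ^ ((n : ℝ) / 2) * (η * s) ^ ((2 * k : ℝ) + ((n : ℝ) - 2) / 2)
      = η ^ (2 * k + n - 1 : ℝ) * s ^ ((2 * k + n - 1 : ℝ)) := by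
    rw [← Real.rpow_add (by positivity), ← Real.mul_rpow hη.le hs.le]
    congr 1; ring
  rw [e1, e2, Real.div_rpow (by positivity) (by norm_num), cB]
  calc _ = Real.exp (-(s ^ (2 * m))) * ((η * s) ^ ((n : ℝ) / 2) *
      (η * s) ^ ((2 * k : ℝ) + ((n : ℝ) - 2) / 2)) * ((-1 : ℝ) ^ k /
        ((2 : ℝ) ^ ((2 * k : ℝ) + ((n : ℝ) - 2) / 2) *
          (Nat.factorial k * Real.Gamma ((k : ℝ) + n / 2)))) := by
        simp only [div_eq_mul_inv, mul_inv]; ring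
    _ = _ := by rw [e3]; ring

theorem rpow_split {n : ℕ} (k : ℕ) {η : ℝ} (hη : 0 < η) :
    η ^ (2 * k + n - 1 : ℝ) = η ^ ((n : ℝ) - 1) * (η ^ 2) ^ k := by
  rw [← pow_mul, ← Real.rpow_natCast, ← Real.rpow_add hη]
  congr 1; push_cast; ring

theorem fmn_eq {m n : ℕ} (hm : 1 ≤ m) (hn : 1 ≤ n) {η : ℝ} (hη : 0 < η) :
    fmn m n η = PS (fun k => cB n k * mI m n k) (η ^ 2) := by
  set F : ℕ → ℝ → ℝ := fun k s => (cB n k * η ^ (2 * k + n - 1 : ℝ)) *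
        (s ^ ((2 * k + n - 1 : ℝ)) * Real.exp (-s ^ (2 * m : ℝ))) with hF
  have hFint : ∀ k, Integrable (F k) (volume.restrict (Set.Ioi 0)) := fun k =>
    (mI_integrable hm hn k).const_mul _
  have hFi : ∀ k, ∫ s in Set.Ioi (0 : ℝ), F k s
      = η ^ ((n : ℝ) - 1) * (cB n k * mI m n k * (η ^ 2) ^ k) := by
    intro k
    simp only [hF]
    rw [integral_const_mul, rpow_split k hη]
    simp only [mI]; ring
  have hnorm : ∀ k, ∫ s in Set.Ioi (0 : ℝ), ‖F k s‖
      = η ^ ((n : ℝ) - 1) * |cB n k * mI m n k * (η ^ 2) ^ k| := by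
    intro k
    have : ∫ s in Set.Ioi (0 : ℝ), ‖F k s‖ = ∫ s in Set.Ioi (0 : ℝ),
        |cB n k * η ^ (2 * k + n - 1 : ℝ)| *
        (s ^ ((2 * k + n - 1 : ℝ)) * Real.exp (-s ^ (2 * m : ℝ))) := by
      refine setIntegral_congr_fun measurableSet_Ioi fun s hs => ?_
      have hs0 : (0 : ℝ) < s := hs
      simp only [hF]
      rw [norm_mul, Real.norm_eq_abs, Real.norm_eq_abs, abs_of_nonneg (a := s ^ _ * _)
        (by positivity)]
    have h0 := mI_nonneg hm hn k
    rw [this, integral_const_mul, rpow_split k hη]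
    simp only [abs_mul, abs_pow, abs_of_nonneg h0]
    rw [abs_of_nonneg (a := η ^ ((n : ℝ) - 1)) (by positivity)]
    simp only [mI]; ring
  have hsum : Summable fun k => ∫ s in Set.Ioi (0 : ℝ), ‖F k s‖ := by
    simp_rw [hnorm]
    exact ((ent_coef hm hn (η ^ 2)).abs).mul_left _
  have hs := integral_tsum_of_summable_integral_norm hFint hsum
  have hI : ∫ s in Set.Ioi (0 : ℝ), Real.exp (-(s ^ (2 * m))) * (η * s) ^ ((n : ℝ) / 2) *
        besselJ (((n : ℝ) - 2) / 2) (η * s) = ∫ s in Set.Ioi (0 : ℝ), ∑' k, F k s := by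
    refine setIntegral_congr_fun measurableSet_Ioi fun s hs => ?_
    have hs0 : (0 : ℝ) < s := hs
    simp only [besselJ, ← tsum_mul_left]
    exact tsum_congr fun k => term_eq m n k hη hs0
  rw [fmn, hI, ← hs]
  simp_rw [hFi]
  rw [tsum_mul_left, ← mul_assoc, ← Real.rpow_add hη]
  simp [PS]

/-- The coefficients of the rescaled kernel. -/
noncomputable def vB (m n : ℕ) (C lam : ℝ) (k : ℕ) : ℝ := C * (lam ^ 2) ^ k * (cB n k * mI m n k)

theorem ent_vB {m n : ℕ} (hm : 1 ≤ m) (hn : 1 ≤ n) (C lam : ℝ) : Ent (vB m n C lam) := fun r =>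
  ((ent_coef hm hn (lam ^ 2 * r)).mul_left C).congr fun k => by
    simp only [vB, mul_pow]; ring

theorem PS_vB (m n : ℕ) (C lam x : ℝ) :
    PS (vB m n C lam) x = C * PS (fun k => cB n k * mI m n k) (lam ^ 2 * x) := by
  rw [PS, PS, ← tsum_mul_left]
  exact tsum_congr fun k => by simp only [vB, mul_pow]; ring

theorem vB_rec {m n : ℕ} (hm : 1 ≤ m) (hn : 1 ≤ n) {C lam : ℝ}
    (hlam : lam ^ (2 * m) = 2 * m) (k : ℕ) :
    (-1 : ℝ) ^ m * (TS n)^[m] (vB m n C lam) k = (2 * k + n) * vB m n C lam k := by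
  have hn' : (1 : ℝ) ≤ n := by exact_mod_cast hn
  have hm' : (1 : ℝ) ≤ m := by exact_mod_cast hm
  have hG : Real.Gamma (k + n / 2 : ℝ) ≠ 0 := (Real.Gamma_pos_of_pos (by positivity)).ne'
  have hG2 : Real.Gamma (k + m + n / 2 : ℝ) ≠ 0 := (Real.Gamma_pos_of_pos (by positivity)).ne'
  have hf : (k.factorial : ℝ) ≠ 0 := by positivity
  have hf2 : ((k + m).factorial : ℝ) ≠ 0 := by positivity
  have e1 : (2 : ℝ) ^ ((2 * ((k + m : ℕ) : ℝ)) + ((n : ℝ) - 2) / 2)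
      = 4 ^ m * (2 : ℝ) ^ ((2 * k : ℝ) + ((n : ℝ) - 2) / 2) := by
    have : (4 : ℝ) ^ m = (2 : ℝ) ^ (2 * m : ℝ) := by
      rw [show (4 : ℝ) = 2 ^ 2 by norm_num, ← pow_mul, ← Real.rpow_natCast]
      push_cast; rfl
    rw [this, ← Real.rpow_add (by norm_num)]
    congr 1; push_cast; ring
  have e2 : (lam ^ 2) ^ (k + m) = (lam ^ 2) ^ k * (2 * m) := by
    rw [pow_add, ← pow_mul lam 2 m, hlam]
  have e3 : ((-1 : ℝ) ^ m) * (-1) ^ m = 1 := by rw [← mul_pow]; simp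
  rw [TS_iter hn]
  simp only [vB]
  rw [mI_rec hm hn, e2]
  simp only [cB]
  rw [e1, pow_add (-1 : ℝ)]
  have h2 : (2 : ℝ) ^ ((2 * k : ℝ) + ((n : ℝ) - 2) / 2) ≠ 0 := by positivity
  generalize (2 : ℝ) ^ ((2 * k : ℝ) + ((n : ℝ) - 2) / 2) = Q at *
  push_cast
  generalize Real.Gamma (k + m + n / 2 : ℝ) = G2 at *
  generalize Real.Gamma (k + n / 2 : ℝ) = G1 at *
  generalize (-1 : ℝ) ^ m = E at *
  have hE : E ^ 2 = 1 := by rw [sq]; exact e3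
  field_simp
  rw [hE]; ring

/-! ### Removing the singular value at the origin -/

theorem mderiv_congr {n : ℕ} {v w : EuclideanSpace ℝ (Fin n) → ℝ} (h : ∀ i, pd i v = pd i w)
    (a : Fin n → ℕ) :
    mderiv a v = mderiv a w ∨ (mderiv a v = v ∧ mderiv a w = w ∧ ∀ i, a i = 0) := by
  have hit : ∀ (i : Fin n) (k : ℕ), k ≠ 0 →
      (fun h x => pd i h x)^[k] v = (fun h x => pd i h x)^[k] w := by
    intro i k hk
    obtain ⟨k, rfl⟩ := Nat.exists_eq_succ_of_ne_zero hk
    rw [Function.iterate_succ_apply, Function.iterate_succ_apply]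
    exact congrArg _ (h i)
  have : ∀ l : List (Fin n),
      (l.foldr (fun i g => (fun h x => pd i h x)^[a i] g) v
        = l.foldr (fun i g => (fun h x => pd i h x)^[a i] g) w) ∨
      (l.foldr (fun i g => (fun h x => pd i h x)^[a i] g) v = v ∧
       l.foldr (fun i g => (fun h x => pd i h x)^[a i] g) w = w ∧ ∀ i ∈ l, a i = 0) := by
    intro l
    induction l with
    | nil => right; simp
    | cons i l ih =>
      simp only [List.foldr_cons]
      rcases ih with ih | ⟨h1, h2, h3⟩
      · left; rw [ih]
      · rw [h1, h2]
        by_cases hi : a i = 0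
        · right
          simp [hi]
          exact h3
        · left; exact hit i _ hi
  rcases this (List.finRange n) with h | ⟨h1, h2, h3⟩
  · left; exact h
  · right; exact ⟨h1, h2, fun i => h3 i (List.mem_finRange i)⟩

theorem pd_even_zero {n : ℕ} {f : EuclideanSpace ℝ (Fin n) → ℝ} (h : ∀ z, f (-z) = f z)
    (i : Fin n) : pd i f 0 = 0 := by
  have e : f ∘ (ContinuousLinearEquiv.neg ℝ : EuclideanSpace ℝ (Fin n) ≃L[ℝ] _) = f :=
    funext fun z => h z
  have h1 := (ContinuousLinearEquiv.neg ℝ :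
    EuclideanSpace ℝ (Fin n) ≃L[ℝ] _).comp_right_fderiv (f := f) (x := 0)
  rw [e] at h1
  have h2 := congrArg (fun L => L (EuclideanSpace.single i 1)) h1
  simp at h2
  unfold pd
  linarith

/-- for every multi-index `α`, the derivative `∂^α v_∞` of the rescaled
polyharmonic kernel is an eigenfunction of the Fokker–Planck operator
`L v = (-Δ)^m v - ∇·(y v)` with eigenvalue `|α|`. -/
theorem fokker_planck_eigenfunctions (m n : ℕ) (hm : 1 ≤ m) (hn : 1 ≤ n)
    (C : ℝ) (hC : 0 < C)
    (hCnorm : (∫ y : EuclideanSpace ℝ (Fin n),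
      C * fmn m n ((2 * m : ℝ) ^ ((1 : ℝ) / (2 * m)) * ‖y‖)) = 1)
    (a : Fin n → ℕ) :
    ∀ y : EuclideanSpace ℝ (Fin n),
      (-1 : ℝ) ^ m *
          (lap n)^[m]
            (mderiv a (fun z => C * fmn m n ((2 * m : ℝ) ^ ((1 : ℝ) / (2 * m)) * ‖z‖))) y
        - divYV n
            (mderiv a (fun z => C * fmn m n ((2 * m : ℝ) ^ ((1 : ℝ) / (2 * m)) * ‖z‖))) y
      = (∑ i : Fin n, a i : ℝ) *
          mderiv a (fun z => C * fmn m n ((2 * m : ℝ) ^ ((1 : ℝ) / (2 * m)) * ‖z‖)) y := by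
  set lam : ℝ := (2 * m : ℝ) ^ ((1 : ℝ) / (2 * m)) with hlamdef
  have hm' : (1 : ℝ) ≤ m := by exact_mod_cast hm
  have hlam0 : 0 < lam := by positivity
  have hlam : lam ^ (2 * m) = 2 * m := by
    rw [← Real.rpow_natCast, hlamdef, ← Real.rpow_mul (by positivity)]
    push_cast
    rw [one_div_mul_cancel (by positivity), Real.rpow_one]
  set v : EuclideanSpace ℝ (Fin n) → ℝ := fun z => C * fmn m n (lam * ‖z‖) with hv
  set w : EuclideanSpace ℝ (Fin n) → ℝ := fun z => PS (vB m n C lam) (‖z‖ ^ 2) with hw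
  have hE : Eig m n 0 w := Eig.radial (ent_vB hm hn C lam) (vB_rec hm hn hlam)
  have hvw : ∀ z, z ≠ 0 → v z = w z := by
    intro z hz
    have : 0 < ‖z‖ := norm_pos_iff.2 hz
    simp only [hv, hw]
    rw [fmn_eq hm hn (by positivity), PS_vB, mul_pow]
  have hpd : ∀ i, pd i v = pd i w := by
    intro i
    funext z
    by_cases hz : z = 0
    · subst hz
      rw [pd_even_zero (fun z => by simp [hv]), pd_even_zero (fun z => by simp [hw])]
    · unfold pd
      have : v =ᶠ[𝓝 z] w := by
        filter_upwards [isOpen_ne.mem_nhds hz] with x hx using hvw x hx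
      rw [this.fderiv_eq]
  have key := (hE.mderiv a).2
  intro y
  rcases mderiv_congr hpd a with h | ⟨h1, h2, h3⟩
  · rw [h]; exact key y
  · have hky := key y
    rw [h2] at hky
    rw [h1]
    have hz : (∑ i : Fin n, (a i : ℝ)) = 0 := by simp [h3]
    rw [hz, zero_mul] at hky ⊢
    have hl : (lap n)^[m] v = (lap n)^[m] w := by
      obtain ⟨k, rfl⟩ : ∃ k, m = k + 1 := ⟨m - 1, by omega⟩
      rw [Function.iterate_succ_apply, Function.iterate_succ_apply]
      congr 1
      funext x
      simp only [lap, hpd]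
    have hd : divYV n v = divYV n w := by
      funext x
      unfold divYV
      refine Finset.sum_congr rfl fun i _ => ?_
      congr 1
      funext z
      by_cases hz : z = 0
      · subst hz; simp
      · rw [hvw z hz]
    rw [hl, hd]
    exact hky
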